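/- arXiv:math/0608372 — 4 statements merged into one kernel-verified Lean document; each statement's English description precedes it below -/
import Mathlib

section
/- Let N > 1 be an integer, w ≥ 2 an even integer, n an integer with 0 < n < w, and let f be a cusp form of weight w+2 on Γ₀(N). Then the unfolded Petersson integral identity holds: ∫₀^∞ ∫_{−∞}^{∞} y^w · f(x+iy) · (x−iy)^{−(w−n+1)} dx dy = 2πi · C(w,n) · (i/2)^{w−n} · (2i)^{−n−1} · ∫₀^{i∞} f(z) z^n dz, where the double integral converges absolutely and C(w,n) is the binomial coefficient. -/
open MeasureTheory

noncomputable section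

/-- Extension of a function on the upper half-plane to `ℂ` (by `0` off `ℍ`). -/
def extH (f : UpperHalfPlane → ℂ) (z : ℂ) : ℂ :=
  if h : 0 < z.im then f ⟨z, h⟩ else 0

/-- The `n`-th period `r_n(f) = ∫₀^{i∞} f(z) z^n dz`, parametrized by `z = it`. -/
def periodN (n : ℕ) (f : UpperHalfPlane → ℂ) : ℂ :=
  ∫ t in Set.Ioi (0 : ℝ), extH f (Complex.I * t) * (Complex.I * t) ^ n * Complex.I

open UpperHalfPlane in
lemma cusp_bound_aux {Γ : Subgroup (GL (Fin 2) ℝ)} [Γ.IsArithmetic] (w : ℕ) (hw : 2 ≤ w)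
    (f : CuspForm Γ ((w : ℤ) + 2)) :
    ∃ C : ℝ, 0 ≤ C ∧ ∀ τ : ℍ, ‖f τ‖ ≤ C * τ.im ^ (-((w : ℝ) + 1 / 2)) := by
  obtain ⟨C₁, h1⟩ := CuspFormClass.exists_bound f
  obtain ⟨c, hc, h2⟩ := ModularFormClass.exp_decay_atImInfty' f (CuspFormClass.zero_at_infty f)
  have h3 : (fun τ : ℍ => Real.exp (-c * τ.im)) =O[atImInfty]
      fun τ : ℍ => τ.im ^ (-((w : ℝ) + 1 / 2)) :=
    ((isLittleO_exp_neg_mul_rpow_atTop hc (-((w : ℝ) + 1 / 2))).isBigO).comp_tendsto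
      (Filter.tendsto_comap)
  obtain ⟨C₂, h4⟩ := (h2.trans h3).bound
  obtain ⟨A, hA⟩ := (atImInfty_mem _).1 h4
  set B := max A 1
  have hC1 : 0 ≤ C₁ := by
    have := (norm_nonneg _).trans (h1 I)
    simpa using this
  refine ⟨max C₂ (C₁ * B ^ ((w : ℝ) / 2 - 1 / 2)), le_max_of_le_right (by positivity), fun τ => ?_⟩
  have hτ := τ.im_pos
  by_cases h : A ≤ τ.im
  · have := hA τ h
    simp only [Set.mem_ofPred_eq] at this
    rw [Real.norm_of_nonneg (by positivity)] at this
    exact this.trans (by gcongr; exact le_max_left _ _)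
  · have hB : τ.im ≤ B := (not_le.1 h).le.trans (le_max_left _ _)
    have := h1 τ
    refine this.trans ?_
    have e : τ.im ^ (-((w : ℝ) + 1 / 2)) =
        (τ.im ^ ((((w : ℤ) + 2 : ℤ) : ℝ) / 2))⁻¹ * (τ.im ^ ((w : ℝ) / 2 - 1 / 2))⁻¹ := by
      rw [← Real.rpow_neg hτ.le, ← Real.rpow_neg hτ.le, ← Real.rpow_add hτ]
      congr 1; push_cast; ring
    have hle : τ.im ^ ((w : ℝ) / 2 - 1 / 2) ≤ B ^ ((w : ℝ) / 2 - 1 / 2) := by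
      apply Real.rpow_le_rpow hτ.le hB
      have : (2 : ℝ) ≤ w := by exact_mod_cast hw
      linarith
    calc _ ≤ (C₁ * B ^ ((w : ℝ) / 2 - 1 / 2)) * τ.im ^ (-((w : ℝ) + 1 / 2)) := by
            rw [e, div_eq_mul_inv]
            have h5 : 1 ≤ B ^ ((w : ℝ) / 2 - 1 / 2) * (τ.im ^ ((w : ℝ) / 2 - 1 / 2))⁻¹ := by
              rw [← div_eq_mul_inv, one_le_div (by positivity)]
              exact hle
            have h6 : 0 ≤ C₁ * (τ.im ^ ((((w : ℤ) + 2 : ℤ) : ℝ) / 2))⁻¹ := by positivity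
            nlinarith [mul_le_mul_of_nonneg_left h5 h6]
      _ ≤ _ := by gcongr; exact le_max_right _ _

open UpperHalfPlane ConjAct Pointwise in
lemma cusp_bound_aux2 {Γ : Subgroup (GL (Fin 2) ℝ)} [Γ.IsArithmetic] (w : ℕ) (hw : 2 ≤ w)
    (f : CuspForm Γ ((w : ℤ) + 2)) :
    ∃ C : ℝ, 0 ≤ C ∧ ∀ τ : ℍ,
      ‖f τ‖ ≤ C * ‖(τ : ℂ)‖ ^ (w - 1) * τ.im ^ (-((w : ℝ) + 1 / 2)) := by
  have : ((toConjAct (ModularGroup.S : GL (Fin 2) ℝ)⁻¹) • Γ).IsArithmetic := by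
    simpa [(show Rat.castHom ℝ = algebraMap ℚ ℝ by rfl), map_inv, Matrix.SpecialLinearGroup.map_mapGL]
      using! Subgroup.IsArithmetic.conj Γ (Matrix.SpecialLinearGroup.mapGL ℚ ModularGroup.S)⁻¹
  obtain ⟨C, hC, h⟩ := cusp_bound_aux w hw (CuspForm.translate f ModularGroup.S)
  refine ⟨C, hC, fun τ => ?_⟩
  have h1 := h (ModularGroup.S • τ)
  rw [CuspForm.coe_translate, ModularForm.SL_slash_apply] at h1
  rw [← mul_smul] at h1
  have e1 : (ModularGroup.S * ModularGroup.S) • τ = τ := by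
    ext
    rw [mul_smul, UpperHalfPlane.modular_S_smul, UpperHalfPlane.modular_S_smul]
    simp
  rw [e1] at h1
  have hτ := τ.im_pos
  have hz : 0 < ‖(τ : ℂ)‖ := norm_pos_iff.2 τ.ne_zero
  have e2 : (ModularGroup.S • τ).im = τ.im / ‖(τ : ℂ)‖ ^ 2 := by
    rw [UpperHalfPlane.modular_S_smul]
    simp [Complex.normSq_eq_norm_sq, ← UpperHalfPlane.coe_im]
    ring
  have e3 : ‖denom (ModularGroup.S : GL (Fin 2) ℝ) ((ModularGroup.S • τ : ℍ) : ℂ)‖ = ‖(τ : ℂ)‖⁻¹ := by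
    rw [ModularGroup.denom_S, UpperHalfPlane.modular_S_smul]
    simp
  rw [norm_mul, norm_zpow, e3, e2] at h1
  have e4 : ‖(τ : ℂ)‖⁻¹ ^ (-((w : ℤ) + 2)) = ‖(τ : ℂ)‖ ^ (w + 2) := by
    rw [zpow_neg, inv_zpow, inv_inv]
    exact_mod_cast rfl
  have e5 : (τ.im / ‖(τ : ℂ)‖ ^ 2) ^ (-((w : ℝ) + 1 / 2)) =
      τ.im ^ (-((w : ℝ) + 1 / 2)) * ‖(τ : ℂ)‖ ^ (2 * w + 1) := by
    rw [Real.div_rpow hτ.le (by positivity), div_eq_mul_inv, ← Real.rpow_neg (by positivity),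
      ← Real.rpow_natCast, ← Real.rpow_mul hz.le, ← Real.rpow_natCast]
    congr 2; push_cast; ring
  rw [e4, e5] at h1
  have e6 : ‖(τ : ℂ)‖ ^ (2 * w + 1) = ‖(τ : ℂ)‖ ^ (w - 1) * ‖(τ : ℂ)‖ ^ (w + 2) := by
    rw [← pow_add]; congr 1; omega
  rw [e6] at h1
  have hp : 0 < ‖(τ : ℂ)‖ ^ (w + 2) := by positivity
  refine le_of_mul_le_mul_right (h1.trans_eq ?_) hp
  ring

lemma extH_coe (f : UpperHalfPlane → ℂ) (τ : UpperHalfPlane) : extH f τ = f τ := by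
  have : 0 < (τ : ℂ).im := τ.im_pos
  simp only [extH, this, dif_pos]

open UpperHalfPlane in
lemma extH_facts (N w : ℕ) (hN : 1 < N) (hw : 2 ≤ w)
    (f : CuspForm (CongruenceSubgroup.Gamma0 N) ((w : ℤ) + 2)) :
    DifferentiableOn ℂ (extH f) {z | 0 < z.im} ∧
    (∃ C : ℝ, 0 ≤ C ∧ ∀ z : ℂ, 0 < z.im →
      ‖extH f z‖ ≤ C * z.im ^ (-((w : ℝ) + 1 / 2)) ∧
      ‖extH f z‖ ≤ C * ‖z‖ ^ (w - 1) * z.im ^ (-((w : ℝ) + 1 / 2))) ∧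
    ∃ a : ℕ → ℂ, ∀ z : ℂ, 0 < z.im →
      HasSum (fun m : ℕ => a m * Complex.exp (2 * Real.pi * Complex.I * m * z)) (extH f z) := by
  have : NeZero N := ⟨by omega⟩
  refine ⟨?_, ?_, ?_⟩
  · have h := UpperHalfPlane.mdifferentiable_iff.1 (CuspFormClass.holo f)
    refine h.congr fun z hz => ?_
    lift z to ℍ using hz
    simp [extH_coe]
  · obtain ⟨C, hC, h⟩ := cusp_bound_aux w hw f
    obtain ⟨C', hC', h'⟩ := cusp_bound_aux2 w hw f
    refine ⟨max C C', le_max_of_le_left hC, fun z hz => ?_⟩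
    lift z to ℍ using hz
    rw [extH_coe]
    have hτ := z.im_pos
    constructor
    · refine (h z).trans ?_
      rw [coe_im]
      gcongr
      exact le_max_left _ _
    · refine (h' z).trans ?_
      rw [coe_im]
      gcongr
      exact le_max_right _ _
  · refine ⟨fun m => (qExpansion 1 f).coeff m, fun z hz => ?_⟩
    lift z to ℍ using hz
    rw [extH_coe]
    have h := ModularForm.hasSum_qExpansion f (h := 1) one_pos (by simp) z
    refine h.congr_fun ?_
    intro m
    simp only [Function.Periodic.qParam, smul_eq_mul, ← Complex.exp_nat_mul]
    congr 2
    simp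
    ring

lemma ioi_integrable {E : Type*} [NormedAddCommGroup E] {h : ℝ → E} {C α β : ℝ}
    (hm : AEStronglyMeasurable h (volume.restrict (Set.Ioi 0))) (hα : -1 < α) (hβ : β < -1)
    (h1 : ∀ t, 0 < t → ‖h t‖ ≤ C * t ^ α) (h2 : ∀ t, 0 < t → ‖h t‖ ≤ C * t ^ β) :
    IntegrableOn h (Set.Ioi 0) := by
  rw [← Set.Ioc_union_Ioi_eq_Ioi (zero_le_one (α := ℝ))]
  refine IntegrableOn.union ?_ ?_
  · have i := (intervalIntegrable_iff_integrableOn_Ioc_of_le zero_le_one).1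
      (intervalIntegral.intervalIntegrable_rpow' (a := 0) (b := 1) hα)
    refine Integrable.mono' (i.const_mul C) (hm.mono_measure
      (Measure.restrict_mono Set.Ioc_subset_Ioi_self le_rfl)) ?_
    filter_upwards [ae_restrict_mem measurableSet_Ioc] with t ht using h1 t ht.1
  · have i := integrableOn_Ioi_rpow_of_lt hβ one_pos
    refine Integrable.mono' (i.const_mul C) (hm.mono_measure
      (Measure.restrict_mono (Set.Ioi_subset_Ioi zero_le_one) le_rfl)) ?_
    filter_upwards [ae_restrict_mem measurableSet_Ioi] with t ht using h2 t (one_pos.trans ht)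

/-- one-dimensional dominating function -/
def domG (t : ℝ) : ℝ := min (|t| ^ (-(3 / 4) : ℝ)) (|t| ^ (-(5 / 4) : ℝ))

lemma domG_integrableOn : IntegrableOn domG (Set.Ioi 0) := by
  refine ioi_integrable (C := 1) (α := -(3 / 4)) (β := -(5 / 4)) ?_ (by norm_num) (by norm_num)
    ?_ ?_
  · apply Measurable.aestronglyMeasurable
    unfold domG
    fun_prop
  · intro t ht
    rw [domG, Real.norm_of_nonneg (by positivity), abs_of_pos ht, one_mul]
    exact min_le_left _ _
  · intro t ht
    rw [domG, Real.norm_of_nonneg (by positivity), abs_of_pos ht, one_mul]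
    exact min_le_right _ _

lemma domG_integrable : Integrable domG := by
  rw [← integrableOn_univ, ← Set.Iic_union_Ioi (a := (0 : ℝ))]
  refine IntegrableOn.union ?_ domG_integrableOn
  rw [← Measure.map_neg_eq_self (volume : Measure ℝ)]
  let m : MeasurableEmbedding fun x : ℝ => -x := (Homeomorph.neg ℝ).measurableEmbedding
  rw [m.integrableOn_map_iff]
  have : (domG ∘ fun x : ℝ => -x) = domG := by ext x; simp [domG]
  rw [this]
  simp only [Set.neg_preimage, Set.neg_Iic, neg_zero]
  exact (integrableOn_Ici_iff_integrableOn_Ioi (by simp)).2 domG_integrableOn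

lemma part3 (w n : ℕ) (hw : 2 ≤ w) (hn : 0 < n) (hnw : n < w) (F : ℂ → ℂ)
    (hd : DifferentiableOn ℂ F {z | 0 < z.im}) (C : ℝ) (hC : 0 ≤ C)
    (hb : ∀ z : ℂ, 0 < z.im → ‖F z‖ ≤ C * z.im ^ (-((w : ℝ) + 1 / 2)) ∧
      ‖F z‖ ≤ C * ‖z‖ ^ (w - 1) * z.im ^ (-((w : ℝ) + 1 / 2))) :
    IntegrableOn
      (fun p : ℝ × ℝ =>
        (p.2 : ℂ) ^ w * F ((p.1 : ℂ) + (p.2 : ℂ) * Complex.I) *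
          ((p.1 : ℂ) - (p.2 : ℂ) * Complex.I) ^ (-((w : ℤ) - n + 1)))
      (Set.univ ×ˢ Set.Ioi (0 : ℝ)) := by
  have hdom : IntegrableOn (fun p : ℝ × ℝ => domG p.1 * domG p.2)
      (Set.univ ×ˢ Set.Ioi (0 : ℝ)) := by
    rw [IntegrableOn, Measure.volume_eq_prod, ← Measure.prod_restrict, Measure.restrict_univ]
    exact domG_integrable.mul_prod domG_integrableOn
  have hms : MeasurableSet ((Set.univ : Set ℝ) ×ˢ Set.Ioi (0 : ℝ)) :=
    MeasurableSet.univ.prod measurableSet_Ioi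
  have hk : (-((w : ℤ) - n + 1)) = -((w - n + 1 : ℕ) : ℤ) := by
    push_cast [Nat.cast_sub hnw.le]; ring
  refine Integrable.mono' (hdom.const_mul C) ?_ ?_
  · refine ContinuousOn.aestronglyMeasurable ?_ hms
    refine ContinuousOn.mul (ContinuousOn.mul (by fun_prop) ?_) ?_
    · refine hd.continuousOn.comp (by fun_prop) ?_
      rintro ⟨x, y⟩ ⟨-, hy⟩
      simpa using hy
    · refine ContinuousOn.zpow₀ (by fun_prop) _ ?_
      rintro ⟨x, y⟩ ⟨-, hy⟩
      left
      intro h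
      have := congrArg Complex.im h
      simp at this
      simp only [Set.mem_Ioi] at hy
      exact hy.ne' this
  · have h0 : ∀ᵐ p : ℝ × ℝ, p.1 ≠ 0 := by
      rw [Measure.volume_eq_prod]
      have h1 : ∀ᵐ x : ℝ, x ≠ 0 := by simp [ae_iff]
      exact Measure.quasiMeasurePreserving_fst.ae h1
    filter_upwards [ae_restrict_mem hms, ae_restrict_of_ae h0] with p hp hp0
    obtain ⟨x, y⟩ := p
    have hy : 0 < y := hp.2
    have hx : 0 < |x| := abs_pos.2 hp0
    simp only at hp0 ⊢
    set z : ℂ := (x : ℂ) + (y : ℂ) * Complex.I with hz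
    set r := ‖z‖ with hr
    have him : z.im = y := by simp [hz]
    have hre : z.re = x := by simp [hz]
    have hyr : y ≤ r := by rw [← him]; exact (le_abs_self _).trans (Complex.abs_im_le_norm z)
    have hxr : |x| ≤ r := by rw [← hre]; exact Complex.abs_re_le_norm z
    have hr0 : 0 < r := hy.trans_le hyr
    have hconj : ‖(x : ℂ) - (y : ℂ) * Complex.I‖ = r := by
      rw [hr, ← Complex.norm_conj z]; congr 1; simp [hz, sub_eq_add_neg]
    have hb' := hb z (by rw [him]; exact hy)
    rw [him] at hb'
    have hyw : y ^ w * y ^ (-((w : ℝ) + 1 / 2)) = y ^ (-(1 / 2) : ℝ) := by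
      rw [← Real.rpow_natCast, ← Real.rpow_add hy]; congr 1; ring
    have key : ∀ s : ℝ, 1 ≤ s → s ≤ 2 →
        ‖(y : ℂ) ^ w * F z * ((x : ℂ) - (y : ℂ) * Complex.I) ^ (-((w : ℤ) - n + 1))‖ ≤
          C * (y ^ (-(1 / 2) : ℝ) * r ^ (-s)) := by
      intro s hs1 hs2
      rw [hk, zpow_neg, zpow_natCast, norm_mul, norm_mul, norm_inv, norm_pow, norm_pow, hconj,
        Complex.norm_real, Real.norm_of_nonneg hy.le]
      rcases le_total 1 r with h | h
      · have : (r ^ (w - n + 1))⁻¹ ≤ r ^ (-s) := by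
          rw [Real.rpow_neg hr0.le]
          apply inv_anti₀ (by positivity)
          rw [← Real.rpow_natCast]
          apply Real.rpow_le_rpow_of_exponent_le h
          refine hs2.trans ?_
          have : 2 ≤ w - n + 1 := by omega
          exact_mod_cast this
        calc _ ≤ y ^ w * (C * y ^ (-((w : ℝ) + 1 / 2))) * r ^ (-s) := by
              gcongr
              exact hb'.1
          _ = _ := by rw [← hyw]; ring
      · have : r ^ (w - 1) * (r ^ (w - n + 1))⁻¹ ≤ r ^ (-s) := by
          have e : r ^ (w - 1) * (r ^ (w - n + 1))⁻¹ = r ^ ((n : ℝ) - 2) := by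
            rw [← Real.rpow_natCast, ← Real.rpow_natCast, ← Real.rpow_neg hr0.le,
              ← Real.rpow_add hr0]
            congr 1
            push_cast [Nat.cast_sub hnw.le, Nat.cast_sub (show 1 ≤ w by omega)]
            ring
          rw [e]
          apply Real.rpow_le_rpow_of_exponent_ge hr0 h
          have : (1 : ℝ) ≤ n := by exact_mod_cast hn
          linarith
        calc _ ≤ y ^ w * (C * r ^ (w - 1) * y ^ (-((w : ℝ) + 1 / 2))) * (r ^ (w - n + 1))⁻¹ := by
              gcongr
              exact hb'.2
          _ = C * ((y ^ w * y ^ (-((w : ℝ) + 1 / 2))) * (r ^ (w - 1) * (r ^ (w - n + 1))⁻¹)) := by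
              ring
          _ ≤ _ := by rw [hyw]; gcongr
    have key2 : ∀ a b : ℝ, 3 / 4 ≤ a → a ≤ 5 / 4 → 3 / 4 ≤ b → b ≤ 5 / 4 →
        ‖(y : ℂ) ^ w * F z * ((x : ℂ) - (y : ℂ) * Complex.I) ^ (-((w : ℤ) - n + 1))‖ ≤
          C * (|x| ^ (-a) * |y| ^ (-b)) := by
      intro a b ha ha' hb hb'
      refine (key (a + b - 1 / 2) (by linarith) (by linarith)).trans ?_
      refine mul_le_mul_of_nonneg_left ?_ hC
      have e : r ^ (-(a + b - 1 / 2)) = r ^ (-a) * r ^ (-(b - 1 / 2)) := by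
        rw [← Real.rpow_add hr0]; congr 1; ring
      have e2 : |y| ^ (-b) = y ^ (-(1 / 2) : ℝ) * y ^ (-(b - 1 / 2)) := by
        rw [abs_of_pos hy, ← Real.rpow_add hy]; congr 1; ring
      have i1 : r ^ (-a) ≤ |x| ^ (-a) := Real.rpow_le_rpow_of_nonpos hx hxr (by linarith)
      have i2 : r ^ (-(b - 1 / 2)) ≤ y ^ (-(b - 1 / 2)) :=
        Real.rpow_le_rpow_of_nonpos hy hyr (by linarith)
      rw [e, e2]
      calc _ ≤ y ^ (-(1 / 2) : ℝ) * (|x| ^ (-a) * y ^ (-(b - 1 / 2))) := by gcongr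
        _ = _ := by ring
    unfold domG
    rcases min_choice (|x| ^ (-(3 / 4) : ℝ)) (|x| ^ (-(5 / 4) : ℝ)) with e | e <;>
    rcases min_choice (|y| ^ (-(3 / 4) : ℝ)) (|y| ^ (-(5 / 4) : ℝ)) with e' | e' <;>
    · rw [e, e']
      apply key2 <;> norm_num

lemma pow_exp_integrable (j : ℕ) {c : ℂ} (hc : 0 < c.re) :
    IntegrableOn (fun t : ℝ => (t : ℂ) ^ j * Complex.exp (-c * t)) (Set.Ioi 0) := by
  have h := integrableOn_rpow_mul_exp_neg_mul_rpow (p := 1) (s := j) (b := c.re)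
    (by have : (0 : ℝ) ≤ j := by positivity
        linarith) one_pos hc
  refine Integrable.mono' h (by fun_prop) ?_
  filter_upwards [ae_restrict_mem measurableSet_Ioi] with t ht
  have ht : 0 < t := ht
  rw [norm_mul, norm_pow, Complex.norm_exp, Complex.norm_real, Real.norm_of_nonneg ht.le]
  simp

lemma pow_exp_integral (j : ℕ) {c : ℂ} (hc : 0 < c.re) :
    ∫ t in Set.Ioi (0 : ℝ), (t : ℂ) ^ j * Complex.exp (-c * t) = j.factorial / c ^ (j + 1) := by
  have hc0 : c ≠ 0 := by rintro rfl; simp at hc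
  induction j with
  | zero =>
    have := integral_exp_mul_complex_Ioi (a := -c) (by simpa using hc) 0
    simp only [pow_zero, one_mul]
    rw [this]
    simp
  | succ j ih =>
    have key := integral_Ioi_mul_deriv_eq_deriv_mul (a := (0 : ℝ)) (a' := (0 : ℂ)) (b' := (0 : ℂ))
      (u := fun t : ℝ => (t : ℂ) ^ (j + 1)) (u' := fun t : ℝ => ((j + 1 : ℕ) : ℂ) * (t : ℂ) ^ j)
      (v := fun t : ℝ => -(Complex.exp (-c * t) / c)) (v' := fun t : ℝ => Complex.exp (-c * t))
      ?_ ?_ ?_ ?_ ?_ ?_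
    · rw [key]
      have e : ∀ t : ℝ, ((j + 1 : ℕ) : ℂ) * (t : ℂ) ^ j * -(Complex.exp (-c * t) / c) =
          (-((j + 1 : ℕ) : ℂ) / c) * ((t : ℂ) ^ j * Complex.exp (-c * t)) := by
        intro t; ring
      simp_rw [e]
      rw [integral_const_mul, ih, Nat.factorial_succ]
      push_cast
      field_simp
      ring
    · intro t _
      simpa using (hasDerivAt_pow (j + 1) (t : ℂ)).comp_ofReal
    · intro t _
      have h0 : HasDerivAt (fun z : ℂ => -(Complex.exp (-c * z) / c))
          (-(Complex.exp (-c * t) * (-c * 1) / c)) (t : ℂ) :=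
        ((((hasDerivAt_id (t : ℂ)).const_mul (-c)).cexp.div_const c)).neg
      have e : -(Complex.exp (-c * t) * (-c * 1) / c) = Complex.exp (-c * t) := by
        field_simp
      rw [e] at h0
      exact h0.comp_ofReal
    · exact pow_exp_integrable (j + 1) hc
    · have := (pow_exp_integrable j hc).const_mul (-((j + 1 : ℕ) : ℂ) / c)
      refine Integrable.congr this (Filter.Eventually.of_forall fun t => ?_)
      show _ = ((j + 1 : ℕ) : ℂ) * (t : ℂ) ^ j * -(Complex.exp (-c * t) / c)
      ring
    · have : Continuous ((fun t : ℝ => (t : ℂ) ^ (j + 1)) *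
          fun t : ℝ => -(Complex.exp (-c * t) / c)) := by
        apply Continuous.mul <;> fun_prop
      have h := (this.tendsto 0).mono_left (nhdsWithin_le_nhds (s := Set.Ioi (0 : ℝ)))
      simpa using h
    · rw [tendsto_zero_iff_norm_tendsto_zero]
      have h := (tendsto_rpow_mul_exp_neg_mul_atTop_nhds_zero (j + 1 : ℕ) c.re hc).mul_const (‖c‖⁻¹)
      rw [zero_mul] at h
      refine h.congr' ?_
      filter_upwards [Filter.eventually_gt_atTop 0] with t ht
      simp only [Pi.mul_apply, norm_mul, norm_neg, norm_div, norm_pow, Complex.norm_exp,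
        Complex.norm_real, Real.norm_of_nonneg ht.le, Real.rpow_natCast]
      simp
      ring

lemma kernel_integrable (k : ℕ) (hk : 2 ≤ k) {y : ℝ} (hy : 0 < y) :
    Integrable (fun x : ℝ => (((x : ℂ) - (y : ℂ) * Complex.I) ^ k)⁻¹) := by
  have hne : ∀ x : ℝ, (x : ℂ) - (y : ℂ) * Complex.I ≠ 0 := by
    intro x h
    have := congrArg Complex.im h
    simp at this
    exact hy.ne' this
  have hcont : Continuous (fun x : ℝ => (((x : ℂ) - (y : ℂ) * Complex.I) ^ k)⁻¹) :=
    Continuous.inv₀ (by fun_prop) (fun x => pow_ne_zero _ (hne x))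
  set M : ℝ := (y ^ (k - 2) * min 1 (y ^ 2))⁻¹
  refine Integrable.mono' (integrable_inv_one_add_sq.const_mul M) hcont.aestronglyMeasurable ?_
  refine Filter.Eventually.of_forall fun x => ?_
  have hy' : y ≤ ‖(x : ℂ) - (y : ℂ) * Complex.I‖ := by
    have := Complex.abs_im_le_norm ((x : ℂ) - (y : ℂ) * Complex.I)
    simp at this
    exact (le_abs_self y).trans this
  have hsq : ‖(x : ℂ) - (y : ℂ) * Complex.I‖ ^ 2 = x ^ 2 + y ^ 2 := by
    rw [← Complex.normSq_eq_norm_sq, Complex.normSq_apply]; simp; ring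
  rw [norm_inv, norm_pow, ← mul_inv]
  apply inv_anti₀ (by positivity)
  have e : ‖(x : ℂ) - (y : ℂ) * Complex.I‖ ^ k =
      ‖(x : ℂ) - (y : ℂ) * Complex.I‖ ^ (k - 2) * (x ^ 2 + y ^ 2) := by
    rw [← hsq, ← pow_add]; congr 1; omega
  rw [e, mul_assoc]
  gcongr
  have h1 := min_le_left 1 (y ^ 2)
  have h2 := min_le_right 1 (y ^ 2)
  nlinarith [sq_nonneg x]

open FourierTransform in
lemma kernel_integral (j : ℕ) (hj : 1 ≤ j) {y : ℝ} (hy : 0 < y) (m : ℕ) :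
    ∫ x : ℝ, Complex.exp (2 * Real.pi * Complex.I * m * x) *
        (((x : ℂ) - (y : ℂ) * Complex.I) ^ (j + 1))⁻¹ =
      2 * Real.pi * Complex.I * (2 * Real.pi * Complex.I * m) ^ j / j.factorial *
        Complex.exp (-(2 * Real.pi * m * y)) := by
  set h : ℝ → ℂ := fun t => ((max t 0 : ℝ) : ℂ) ^ j * Complex.exp (-(2 * Real.pi * y) * t) with hh
  have hcont : Continuous h := by
    apply Continuous.mul
    · exact (Complex.continuous_ofReal.comp (continuous_id.max continuous_const)).pow j
    · fun_prop
  have hind : h = (Set.Ioi 0).indicator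
      fun t : ℝ => (t : ℂ) ^ j * Complex.exp (-(2 * Real.pi * y) * t) := by
    ext t
    by_cases ht : 0 < t
    · rw [Set.indicator_of_mem (by exact ht)]
      simp [hh, ht.le]
    · rw [Set.indicator_of_notMem (by exact ht)]
      simp only [hh]
      rw [max_eq_right (not_lt.1 ht)]
      simp [show j ≠ 0 by omega]
  have hIntg : Integrable h := by
    rw [hind, integrable_indicator_iff measurableSet_Ioi]
    exact pow_exp_integrable j (c := 2 * Real.pi * y) (by
      have : (2 * Real.pi * y : ℂ) = ((2 * Real.pi * y : ℝ) : ℂ) := by push_cast; rfl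
      rw [this, Complex.ofReal_re]; positivity)
  have hpi : (Real.pi : ℂ) ≠ 0 := by exact_mod_cast Real.pi_ne_zero
  have hF : 𝓕 h = fun x : ℝ => (j.factorial / (2 * Real.pi * Complex.I) ^ (j + 1) : ℂ) *
      (((x : ℂ) - (y : ℂ) * Complex.I) ^ (j + 1))⁻¹ := by
    ext x
    rw [Real.fourier_real_eq_integral_exp_smul]
    have e1 : ∀ v : ℝ, Complex.exp (↑(-2 * Real.pi * v * x) * Complex.I) • h v =
        (Set.Ioi 0).indicator (fun t : ℝ => (t : ℂ) ^ j *
          Complex.exp (-(2 * Real.pi * Complex.I * (x - y * Complex.I)) * t)) v := by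
      intro v
      rw [hind]
      by_cases hv : v ∈ Set.Ioi (0 : ℝ)
      · rw [Set.indicator_of_mem hv, Set.indicator_of_mem hv, smul_eq_mul, mul_left_comm,
          ← Complex.exp_add]
        congr 2
        push_cast
        linear_combination (-2 * Real.pi * y * v : ℂ) * Complex.I_sq
      · rw [Set.indicator_of_notMem hv, Set.indicator_of_notMem hv, smul_zero]
    simp_rw [e1]
    rw [integral_indicator measurableSet_Ioi, pow_exp_integral]
    · rw [mul_pow, div_mul_eq_div_div, div_eq_mul_inv]
    · have : (2 * Real.pi * Complex.I * (x - y * Complex.I) : ℂ) =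
          ((2 * Real.pi * y : ℝ) : ℂ) + ((2 * Real.pi * x : ℝ) : ℂ) * Complex.I := by
        push_cast
        linear_combination (-2 * Real.pi * y : ℂ) * Complex.I_sq
      rw [this]
      simp only [Complex.add_re, Complex.ofReal_re, Complex.re_ofReal_mul, Complex.I_re, mul_zero,
        add_zero]
      positivity
  have hFint : Integrable (𝓕 h) := by
    rw [hF]
    exact (kernel_integrable (j + 1) (by omega) hy).const_mul _
  have inv := hIntg.fourierInv_fourier_eq hFint (v := (m : ℝ)) hcont.continuousAt
  rw [Real.fourierInv_eq', hF] at inv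
  have e2 : ∀ v : ℝ, Complex.exp (↑(2 * Real.pi * inner ℝ v (m : ℝ)) * Complex.I) •
      ((j.factorial / (2 * Real.pi * Complex.I) ^ (j + 1) : ℂ) *
        (((v : ℂ) - (y : ℂ) * Complex.I) ^ (j + 1))⁻¹) =
      (j.factorial / (2 * Real.pi * Complex.I) ^ (j + 1) : ℂ) *
      (Complex.exp (2 * Real.pi * Complex.I * m * v) *
        (((v : ℂ) - (y : ℂ) * Complex.I) ^ (j + 1))⁻¹) := by
    intro v
    rw [smul_eq_mul, mul_left_comm]
    congr 3
    simp
    ring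
  simp_rw [e2] at inv
  rw [integral_const_mul] at inv
  have hfac : (j.factorial : ℂ) ≠ 0 := by exact_mod_cast j.factorial_ne_zero
  have hm : h (m : ℝ) = (m : ℂ) ^ j * Complex.exp (-(2 * Real.pi * m * y)) := by
    simp only [hh]
    rw [max_eq_left (by positivity)]
    congr 2
    push_cast
    ring
  rw [hm] at inv
  have h2 : (2 * Real.pi * Complex.I : ℂ) ^ (j + 1) ≠ 0 := by
    apply pow_ne_zero; simp [hpi]
  rw [div_mul_eq_mul_div, div_eq_iff h2] at inv
  rw [← mul_right_inj' hfac, inv, mul_pow _ (m : ℂ)]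
  field_simp
  ring

lemma norm_qexp (m : ℕ) (z : ℂ) :
    ‖Complex.exp (2 * Real.pi * Complex.I * m * z)‖ = Real.exp (-(2 * Real.pi * m * z.im)) := by
  rw [Complex.norm_exp]
  congr 1
  have : (2 * Real.pi * Complex.I * m * z : ℂ) = ((2 * Real.pi * m : ℝ) : ℂ) * (Complex.I * z) := by
    push_cast; ring
  rw [this, Complex.re_ofReal_mul]
  simp

lemma qexp_summable {F : ℂ → ℂ} {a : ℕ → ℂ}
    (hq : ∀ z : ℂ, 0 < z.im →
      HasSum (fun m : ℕ => a m * Complex.exp (2 * Real.pi * Complex.I * m * z)) (F z))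
    (j : ℕ) {y : ℝ} (hy : 0 < y) :
    Summable (fun m : ℕ => ‖a m‖ * (2 * Real.pi * m) ^ j * Real.exp (-(2 * Real.pi * m * y))) := by
  have h0 := (hq (((y / 2 : ℝ) : ℂ) * Complex.I) (by simpa using hy)).summable.tendsto_atTop_zero
  obtain ⟨B, hB⟩ := h0.norm.bddAbove_range
  have hB' : ∀ m : ℕ, ‖a m‖ * Real.exp (-(2 * Real.pi * m * (y / 2))) ≤ B := by
    intro m
    have := hB ⟨m, rfl⟩
    simp only [norm_mul (a m), norm_qexp] at this
    simpa using this
  set r : ℝ := Real.exp (-(Real.pi * y)) with hr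
  have hr1 : ‖r‖ < 1 := by
    rw [Real.norm_of_nonneg (Real.exp_pos _).le, Real.exp_lt_one_iff]
    have := Real.pi_pos
    nlinarith [mul_pos this hy]
  have hs := (summable_pow_mul_geometric_of_norm_lt_one j hr1).mul_left (B * (2 * Real.pi) ^ j)
  refine Summable.of_nonneg_of_le (fun m => by positivity) (fun m => ?_) hs
  have e1 : Real.exp (-(2 * Real.pi * m * y)) =
      Real.exp (-(2 * Real.pi * m * (y / 2))) * r ^ m := by
    rw [hr, ← Real.exp_nat_mul, ← Real.exp_add]
    congr 1
    ring
  rw [e1, mul_pow]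
  calc ‖a m‖ * ((2 * Real.pi) ^ j * (m : ℝ) ^ j) *
        (Real.exp (-(2 * Real.pi * m * (y / 2))) * r ^ m)
      = (‖a m‖ * Real.exp (-(2 * Real.pi * m * (y / 2)))) *
        ((2 * Real.pi) ^ j * ((m : ℝ) ^ j * r ^ m)) := by ring
    _ ≤ B * ((2 * Real.pi) ^ j * ((m : ℝ) ^ j * r ^ m)) := by
        apply mul_le_mul_of_nonneg_right (hB' m)
        have : 0 ≤ r := (Real.exp_pos _).le
        positivity
    _ = B * (2 * Real.pi) ^ j * ((m : ℝ) ^ j * r ^ m) := by ring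

lemma qexp_deriv {F : ℂ → ℂ} {a : ℕ → ℂ}
    (hq : ∀ z : ℂ, 0 < z.im →
      HasSum (fun m : ℕ => a m * Complex.exp (2 * Real.pi * Complex.I * m * z)) (F z))
    (j : ℕ) : ∀ z : ℂ, 0 < z.im →
      HasSum (fun m : ℕ => a m * (2 * Real.pi * Complex.I * m) ^ j *
        Complex.exp (2 * Real.pi * Complex.I * m * z)) (iteratedDeriv j F z) := by
  induction j with
  | zero => simpa using hq
  | succ j ih =>
    intro z hz
    have hopen : ∀ c : ℝ, IsOpen {v : ℂ | c < v.im} := fun c =>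
      isOpen_lt continuous_const Complex.continuous_im
    have key := Complex.hasSum_deriv_of_summable_norm
      (F := fun (m : ℕ) (z : ℂ) => a m * (2 * Real.pi * Complex.I * m) ^ j *
        Complex.exp (2 * Real.pi * Complex.I * m * z))
      (U := {v : ℂ | z.im / 2 < v.im}) (z := z)
      (qexp_summable hq j (half_pos hz)) (fun m => by fun_prop) (hopen _) ?_ ?_
    · rw [iteratedDeriv_succ]
      have e : (fun v : ℂ => ∑' m : ℕ, a m * (2 * Real.pi * Complex.I * m) ^ j *
          Complex.exp (2 * Real.pi * Complex.I * m * v)) =ᶠ[nhds z] iteratedDeriv j F := by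
        filter_upwards [(hopen 0).mem_nhds (show z ∈ {v : ℂ | 0 < v.im} from hz)] with v hv
        exact (ih v hv).tsum_eq
      rw [e.deriv_eq] at key
      convert! key using 2 with m
      have h0 : HasDerivAt (fun v : ℂ => a m * (2 * Real.pi * Complex.I * m) ^ j *
          Complex.exp (2 * Real.pi * Complex.I * m * v))
          (a m * (2 * Real.pi * Complex.I * m) ^ j *
          (Complex.exp (2 * Real.pi * Complex.I * m * z) * (2 * Real.pi * Complex.I * m * 1))) z :=
        (((hasDerivAt_id z).const_mul _).cexp).const_mul _
      rw [h0.deriv]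
      ring
    · intro m v hv
      rw [norm_mul, norm_mul, norm_qexp, norm_pow]
      have : ‖(2 * Real.pi * Complex.I * m : ℂ)‖ = 2 * Real.pi * m := by
        simp [abs_of_pos Real.pi_pos]
      rw [this]
      have hv : z.im / 2 < v.im := hv
      have := Real.pi_pos
      gcongr
    · show z.im / 2 < z.im
      linarith

lemma inner_integral {F : ℂ → ℂ} {a : ℕ → ℂ}
    (hq : ∀ z : ℂ, 0 < z.im →
      HasSum (fun m : ℕ => a m * Complex.exp (2 * Real.pi * Complex.I * m * z)) (F z))
    (j : ℕ) (hj : 1 ≤ j) {y : ℝ} (hy : 0 < y) :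
    ∫ x : ℝ, F ((x : ℂ) + (y : ℂ) * Complex.I) *
        (((x : ℂ) - (y : ℂ) * Complex.I) ^ (j + 1))⁻¹ =
      2 * Real.pi * Complex.I / j.factorial * iteratedDeriv j F (2 * Complex.I * y) := by
  have hker := kernel_integrable (j + 1) (by omega) hy
  set G : ℕ → ℝ → ℂ := fun m x => a m * Complex.exp (-(2 * Real.pi * m * y)) *
    (Complex.exp (2 * Real.pi * Complex.I * m * x) *
      (((x : ℂ) - (y : ℂ) * Complex.I) ^ (j + 1))⁻¹) with hG
  have hn1 : ∀ (m : ℕ) (x : ℝ), ‖Complex.exp (2 * Real.pi * Complex.I * m * x)‖ = 1 := by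
    intro m x
    rw [norm_qexp]; simp
  have hIntg : ∀ m, Integrable (G m) := by
    intro m
    refine Integrable.const_mul ?_ _
    refine Integrable.bdd_mul (c := 1) hker (by fun_prop) ?_
    exact Filter.Eventually.of_forall fun x => (hn1 m x).le
  have hne : ∀ m : ℕ, ‖Complex.exp (-(2 * Real.pi * m * y))‖ =
      Real.exp (-(2 * Real.pi * m * y)) := by
    intro m
    rw [show (-(2 * Real.pi * m * y) : ℂ) = ((-(2 * Real.pi * m * y) : ℝ) : ℂ) by push_cast; rfl,
      Complex.norm_exp, Complex.ofReal_re]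
  have hsum : Summable fun m => ∫ x, ‖G m x‖ := by
    have e : ∀ m, ∫ x, ‖G m x‖ = ‖a m‖ * (2 * Real.pi * m) ^ 0 *
        Real.exp (-(2 * Real.pi * m * y)) *
        ∫ x : ℝ, ‖(((x : ℂ) - (y : ℂ) * Complex.I) ^ (j + 1))⁻¹‖ := by
      intro m
      simp only [hG, norm_mul (a m * _), norm_mul (Complex.exp _), hn1, one_mul, norm_mul (a m), hne,
        pow_zero, mul_one]
      rw [integral_const_mul]
    simp_rw [e]
    exact (qexp_summable hq 0 hy).mul_right _
  have H := hasSum_integral_of_summable_integral_norm hIntg hsum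
  have e3 : ∀ x : ℝ, ∑' m, G m x = F ((x : ℂ) + (y : ℂ) * Complex.I) *
        (((x : ℂ) - (y : ℂ) * Complex.I) ^ (j + 1))⁻¹ := by
    intro x
    have h := (hq ((x : ℂ) + (y : ℂ) * Complex.I) (by simpa using hy)).mul_right
      ((((x : ℂ) - (y : ℂ) * Complex.I) ^ (j + 1))⁻¹)
    rw [← h.tsum_eq]
    congr 1
    ext m
    simp only [hG]
    have : Complex.exp (2 * Real.pi * Complex.I * m * ((x : ℂ) + (y : ℂ) * Complex.I)) =
        Complex.exp (-(2 * Real.pi * m * y)) * Complex.exp (2 * Real.pi * Complex.I * m * x) := by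
      rw [← Complex.exp_add]
      congr 1
      linear_combination (2 * Real.pi * m * y : ℂ) * Complex.I_sq
    rw [this]
    ring
  simp_rw [e3] at H
  have H2 := (qexp_deriv hq j (2 * Complex.I * y) (by simpa using hy)).mul_left
    (2 * Real.pi * Complex.I / j.factorial : ℂ)
  refine H.unique ?_
  convert! H2 using 2 with m
  simp only [hG]
  rw [integral_const_mul, kernel_integral j hj hy m]
  have : Complex.exp (2 * Real.pi * Complex.I * m * (2 * Complex.I * y)) =
      Complex.exp (-(2 * Real.pi * m * y)) * Complex.exp (-(2 * Real.pi * m * y)) := by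
    rw [← Complex.exp_add]
    congr 1
    linear_combination (4 * Real.pi * m * y : ℂ) * Complex.I_sq
  rw [this]
  ring

lemma iter_diffOn {F : ℂ → ℂ} (hd : DifferentiableOn ℂ F {z | 0 < z.im}) (i : ℕ) :
    DifferentiableOn ℂ (iteratedDeriv i F) {z | 0 < z.im} := by
  induction i with
  | zero => simpa using hd
  | succ i ih =>
    rw [iteratedDeriv_succ]
    exact ih.deriv (isOpen_lt continuous_const Complex.continuous_im)

lemma iter_hasDerivAt {F : ℂ → ℂ} (hd : DifferentiableOn ℂ F {z | 0 < z.im}) (i : ℕ)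
    {y : ℝ} (hy : 0 < y) :
    HasDerivAt (fun y : ℝ => iteratedDeriv i F (2 * Complex.I * y) / (2 * Complex.I))
      (iteratedDeriv (i + 1) F (2 * Complex.I * y)) y := by
  have h1 : HasDerivAt (iteratedDeriv i F) (iteratedDeriv (i + 1) F (2 * Complex.I * y))
      (2 * Complex.I * y) := by
    rw [iteratedDeriv_succ]
    refine DifferentiableAt.hasDerivAt ((iter_diffOn hd i).differentiableAt ?_)
    apply (isOpen_lt continuous_const Complex.continuous_im).mem_nhds
    show 0 < (2 * Complex.I * (y : ℂ)).im
    simpa using hy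
  have h2 : HasDerivAt (fun z : ℂ => 2 * Complex.I * z) (2 * Complex.I * 1) (y : ℂ) :=
    (hasDerivAt_id (y : ℂ)).const_mul _
  have h3 := ((HasDerivAt.comp (y : ℂ) h1 h2).div_const (2 * Complex.I)).comp_ofReal
  have e : iteratedDeriv (i + 1) F (2 * Complex.I * y) * (2 * Complex.I * 1) / (2 * Complex.I) =
      iteratedDeriv (i + 1) F (2 * Complex.I * y) := by
    have := Complex.I_ne_zero
    field_simp
  rw [e] at h3
  exact h3

lemma iter_meas {F : ℂ → ℂ} (hd : DifferentiableOn ℂ F {z | 0 < z.im}) (i k : ℕ) :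
    AEStronglyMeasurable (fun y : ℝ => (y : ℂ) ^ k * iteratedDeriv i F (2 * Complex.I * y))
      (volume.restrict (Set.Ioi 0)) := by
  apply ContinuousOn.aestronglyMeasurable _ measurableSet_Ioi
  refine ContinuousOn.mul (by fun_prop) ?_
  refine (iter_diffOn hd i).continuousOn.comp (by fun_prop) ?_
  intro y hy
  have hy : 0 < y := hy
  show 0 < (2 * Complex.I * (y : ℂ)).im
  simpa using hy

lemma iter_bound (w : ℕ) (hw : 2 ≤ w) {F : ℂ → ℂ}
    (hd : DifferentiableOn ℂ F {z | 0 < z.im}) {C : ℝ} (hC : 0 ≤ C)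
    (hb : ∀ z : ℂ, 0 < z.im → ‖F z‖ ≤ C * z.im ^ (-((w : ℝ) + 1 / 2)) ∧
      ‖F z‖ ≤ C * ‖z‖ ^ (w - 1) * z.im ^ (-((w : ℝ) + 1 / 2))) (k i : ℕ) :
    ∃ D : ℝ, ∀ y : ℝ, 0 < y →
      ‖(y : ℂ) ^ (k + i) * iteratedDeriv i F (2 * Complex.I * y)‖ ≤ D * y ^ ((k : ℝ) - 3 / 2) ∧
      ‖(y : ℂ) ^ (k + i) * iteratedDeriv i F (2 * Complex.I * y)‖ ≤
        D * y ^ ((k : ℝ) - w - 1 / 2) := by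
  refine ⟨i.factorial * (C * 3 ^ (w - 1)), fun y hy => ?_⟩
  have hsub : ∀ z ∈ Metric.closedBall (2 * Complex.I * (y : ℂ)) y, y ≤ z.im ∧ ‖z‖ ≤ 3 * y := by
    intro z hz
    rw [mem_closedBall_iff_norm] at hz
    constructor
    · have := (Complex.abs_im_le_norm (z - 2 * Complex.I * y)).trans hz
      have e : (z - 2 * Complex.I * y).im = z.im - 2 * y := by simp
      rw [e] at this
      linarith [(abs_le.1 this).1]
    · calc ‖z‖ = ‖(z - 2 * Complex.I * y) + 2 * Complex.I * y‖ := by ring_nf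
        _ ≤ ‖z - 2 * Complex.I * y‖ + ‖2 * Complex.I * (y : ℂ)‖ := norm_add_le _ _
        _ ≤ y + 2 * y := by
            gcongr
            simp [abs_of_pos hy]
        _ = 3 * y := by ring
  have hdc : DiffContOnCl ℂ F (Metric.ball (2 * Complex.I * (y : ℂ)) y) :=
    hd.diffContOnCl_ball (fun z hz => lt_of_lt_of_le hy (hsub z hz).1)
  have him : ∀ z : ℂ, y ≤ z.im → z.im ^ (-((w : ℝ) + 1 / 2)) ≤ y ^ (-((w : ℝ) + 1 / 2)) := by
    intro z hz
    exact Real.rpow_le_rpow_of_nonpos hy hz (by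
      have : (0 : ℝ) ≤ w := by positivity
      linarith)
  have hnorm : ‖(y : ℂ) ^ (k + i)‖ = y ^ (k : ℝ) * y ^ i := by
    rw [norm_pow, Complex.norm_real, Real.norm_of_nonneg hy.le, pow_add, Real.rpow_natCast]
  have h3 : (1 : ℝ) ≤ 3 ^ (w - 1) := one_le_pow₀ (by norm_num)
  have hyi : y ^ i ≠ 0 := by positivity
  constructor
  · have := Complex.norm_iteratedDeriv_le_of_forall_mem_sphere_norm_le (F := ℂ) i hy hdc
      (C := C * 3 ^ (w - 1) * y ^ (-(3 / 2) : ℝ)) ?_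
    · rw [norm_mul, hnorm]
      calc y ^ (k : ℝ) * y ^ i * ‖iteratedDeriv i F (2 * Complex.I * y)‖
          ≤ y ^ (k : ℝ) * y ^ i * (i.factorial * (C * 3 ^ (w - 1) * y ^ (-(3 / 2) : ℝ)) / y ^ i) := by
            gcongr
        _ = i.factorial * (C * 3 ^ (w - 1)) * (y ^ (k : ℝ) * y ^ (-(3 / 2) : ℝ)) := by
            field_simp
        _ = _ := by rw [← Real.rpow_add hy]; congr 2
    · intro z hz
      obtain ⟨h1, h2⟩ := hsub z (Metric.sphere_subset_closedBall hz)
      refine (hb z (hy.trans_le h1)).2.trans ?_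
      calc C * ‖z‖ ^ (w - 1) * z.im ^ (-((w : ℝ) + 1 / 2))
          ≤ C * (3 * y) ^ (w - 1) * y ^ (-((w : ℝ) + 1 / 2)) := by
            have := him z h1
            have hzp : 0 ≤ z.im ^ (-((w : ℝ) + 1 / 2)) := Real.rpow_nonneg (hy.le.trans h1) _
            gcongr
        _ = C * 3 ^ (w - 1) * (y ^ ((w - 1 : ℕ) : ℝ) * y ^ (-((w : ℝ) + 1 / 2))) := by
            rw [Real.rpow_natCast, mul_pow]; ring
        _ = _ := by
            rw [← Real.rpow_add hy]
            congr 2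
            rw [Nat.cast_sub (by omega)]
            push_cast
            ring
  · have := Complex.norm_iteratedDeriv_le_of_forall_mem_sphere_norm_le (F := ℂ) i hy hdc
      (C := C * 3 ^ (w - 1) * y ^ (-((w : ℝ) + 1 / 2))) ?_
    · rw [norm_mul, hnorm]
      calc y ^ (k : ℝ) * y ^ i * ‖iteratedDeriv i F (2 * Complex.I * y)‖
          ≤ y ^ (k : ℝ) * y ^ i *
            (i.factorial * (C * 3 ^ (w - 1) * y ^ (-((w : ℝ) + 1 / 2))) / y ^ i) := by
            gcongr
        _ = i.factorial * (C * 3 ^ (w - 1)) * (y ^ (k : ℝ) * y ^ (-((w : ℝ) + 1 / 2))) := by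
            field_simp
        _ = _ := by rw [← Real.rpow_add hy]; congr 2; ring
    · intro z hz
      obtain ⟨h1, h2⟩ := hsub z (Metric.sphere_subset_closedBall hz)
      refine (hb z (hy.trans_le h1)).1.trans ?_
      have := him z h1
      have h0 : 0 ≤ y ^ (-((w : ℝ) + 1 / 2)) := by positivity
      calc C * z.im ^ (-((w : ℝ) + 1 / 2)) ≤ C * 1 * y ^ (-((w : ℝ) + 1 / 2)) := by
            rw [mul_one]; gcongr
        _ ≤ _ := by gcongr

lemma by_parts (w n : ℕ) (hw : 2 ≤ w) (hn : 0 < n) (hnw : n < w) {F : ℂ → ℂ}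
    (hd : DifferentiableOn ℂ F {z | 0 < z.im}) {C : ℝ} (hC : 0 ≤ C)
    (hb : ∀ z : ℂ, 0 < z.im → ‖F z‖ ≤ C * z.im ^ (-((w : ℝ) + 1 / 2)) ∧
      ‖F z‖ ≤ C * ‖z‖ ^ (w - 1) * z.im ^ (-((w : ℝ) + 1 / 2))) (i : ℕ) :
    ∫ y in Set.Ioi (0 : ℝ), (y : ℂ) ^ (n + i) * iteratedDeriv i F (2 * Complex.I * y) =
      (Complex.I / 2) ^ i * ((n + i).factorial / n.factorial) *
        ∫ y in Set.Ioi (0 : ℝ), (y : ℂ) ^ n * F (2 * Complex.I * y) := by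
  have hn' : (1 : ℝ) ≤ n := by exact_mod_cast hn
  have hnw' : (n : ℝ) + 1 ≤ w := by exact_mod_cast hnw
  have hIntg : ∀ i : ℕ, IntegrableOn
      (fun y : ℝ => (y : ℂ) ^ (n + i) * iteratedDeriv i F (2 * Complex.I * y)) (Set.Ioi 0) := by
    intro i
    obtain ⟨D, hD⟩ := iter_bound w hw hd hC hb n i
    exact ioi_integrable (iter_meas hd i (n + i)) (α := (n : ℝ) - 3 / 2)
      (β := (n : ℝ) - w - 1 / 2) (by linarith) (by linarith)
      (fun t ht => (hD t ht).1) (fun t ht => (hD t ht).2)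
  induction i with
  | zero =>
    have : (n.factorial : ℂ) ≠ 0 := by exact_mod_cast n.factorial_ne_zero
    simp [this]
  | succ i ih =>
    obtain ⟨D, hD⟩ := iter_bound w hw hd hC hb (n + 1) i
    have hI := Complex.I_ne_zero
    have hb0 : ∀ t : ℝ, 0 < t → ‖(t : ℂ) ^ (n + i + 1) *
        (iteratedDeriv i F (2 * Complex.I * t) / (2 * Complex.I))‖ =
        ‖(t : ℂ) ^ (n + 1 + i) * iteratedDeriv i F (2 * Complex.I * t)‖ / 2 := by
      intro t ht
      rw [show n + i + 1 = n + 1 + i by ring, ← mul_div_assoc, norm_div]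
      congr 1
      simp
    have key := integral_Ioi_mul_deriv_eq_deriv_mul (a := (0 : ℝ)) (a' := (0 : ℂ)) (b' := (0 : ℂ))
      (u := fun t : ℝ => (t : ℂ) ^ (n + i + 1))
      (u' := fun t : ℝ => ((n + i + 1 : ℕ) : ℂ) * (t : ℂ) ^ (n + i))
      (v := fun t : ℝ => iteratedDeriv i F (2 * Complex.I * t) / (2 * Complex.I))
      (v' := fun t : ℝ => iteratedDeriv (i + 1) F (2 * Complex.I * t))
      ?_ ?_ ?_ ?_ ?_ ?_
    · rw [show n + (i + 1) = n + i + 1 by ring, key]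
      have e : ∀ t : ℝ, ((n + i + 1 : ℕ) : ℂ) * (t : ℂ) ^ (n + i) *
          (iteratedDeriv i F (2 * Complex.I * t) / (2 * Complex.I)) =
          (((n + i + 1 : ℕ) : ℂ) / (2 * Complex.I)) *
          ((t : ℂ) ^ (n + i) * iteratedDeriv i F (2 * Complex.I * t)) := by
        intro t; ring
      simp_rw [e]
      rw [integral_const_mul, ih, Nat.factorial_succ]
      have e2 : (((n + i + 1 : ℕ) : ℂ) / (2 * Complex.I)) =
          -(Complex.I / 2) * ((n + i + 1 : ℕ) : ℂ) := by
        field_simp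
        rw [Complex.I_sq]
        ring
      rw [e2]
      push_cast
      ring
    · intro t _
      simpa using (hasDerivAt_pow (n + i + 1) (t : ℂ)).comp_ofReal
    · intro t ht
      exact iter_hasDerivAt hd i ht
    · exact hIntg (i + 1)
    · refine Integrable.congr ((hIntg i).const_mul (((n + i + 1 : ℕ) : ℂ) / (2 * Complex.I)))
        (Filter.Eventually.of_forall fun t => ?_)
      show _ = ((n + i + 1 : ℕ) : ℂ) * (t : ℂ) ^ (n + i) *
          (iteratedDeriv i F (2 * Complex.I * t) / (2 * Complex.I))
      ring
    · apply squeeze_zero_norm' (a := fun t : ℝ => D / 2 * t ^ (((n + 1 : ℕ) : ℝ) - 3 / 2))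
      · filter_upwards [self_mem_nhdsWithin] with t ht
        have ht : 0 < t := ht
        refine (hb0 t ht).le.trans ?_
        linarith [(hD t ht).1]
      · have hp : 0 < ((n + 1 : ℕ) : ℝ) - 3 / 2 := by push_cast; linarith
        have h := ((Real.continuousAt_rpow_const 0 _ (Or.inr hp.le)).tendsto.const_mul
          (D / 2)).mono_left (nhdsWithin_le_nhds (s := Set.Ioi (0 : ℝ)))
        rwa [Real.zero_rpow hp.ne', mul_zero] at h
    · apply squeeze_zero_norm' (a := fun t : ℝ => D / 2 * t ^ (((n + 1 : ℕ) : ℝ) - w - 1 / 2))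
      · filter_upwards [Filter.eventually_gt_atTop 0] with t ht
        refine (hb0 t ht).le.trans ?_
        linarith [(hD t ht).2]
      · have hp : 0 < -(((n + 1 : ℕ) : ℝ) - w - 1 / 2) := by push_cast; linarith
        have h := (tendsto_rpow_neg_atTop hp).const_mul (D / 2)
        rwa [mul_zero, neg_neg] at h

theorem unfolded_petersson_integral (N w n : ℕ) (hN : 1 < N) (hw : 2 ≤ w) (hwe : Even w)
    (hn : 0 < n) (hnw : n < w)
    (f : CuspForm (CongruenceSubgroup.Gamma0 N) ((w : ℤ) + 2)) :
    IntegrableOn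
      (fun p : ℝ × ℝ =>
        (p.2 : ℂ) ^ w * extH f ((p.1 : ℂ) + (p.2 : ℂ) * Complex.I) *
          ((p.1 : ℂ) - (p.2 : ℂ) * Complex.I) ^ (-((w : ℤ) - n + 1)))
      (Set.univ ×ˢ Set.Ioi (0 : ℝ)) ∧
    (∫ y in Set.Ioi (0 : ℝ), ∫ x : ℝ,
        (y : ℂ) ^ w * extH f ((x : ℂ) + (y : ℂ) * Complex.I) *
          ((x : ℂ) - (y : ℂ) * Complex.I) ^ (-((w : ℤ) - n + 1))) =
      2 * (Real.pi : ℂ) * Complex.I * (w.choose n : ℂ) * (Complex.I / 2) ^ (w - n) *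
        (2 * Complex.I) ^ (-((n : ℤ) + 1)) * periodN n f := by
  obtain ⟨hd, ⟨C, hC, hb⟩, a, hq⟩ := extH_facts N w hN hw f
  refine ⟨part3 w n hw hn hnw (extH f) hd C hC hb, ?_⟩
  have hI := Complex.I_ne_zero
  have e1 : ∫ y in Set.Ioi (0 : ℝ), ∫ x : ℝ,
        (y : ℂ) ^ w * extH f ((x : ℂ) + (y : ℂ) * Complex.I) *
          ((x : ℂ) - (y : ℂ) * Complex.I) ^ (-((w : ℤ) - n + 1)) =
      ∫ y in Set.Ioi (0 : ℝ), (2 * Real.pi * Complex.I / (w - n).factorial) *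
        ((y : ℂ) ^ (n + (w - n)) * iteratedDeriv (w - n) (extH f) (2 * Complex.I * y)) := by
    refine setIntegral_congr_fun measurableSet_Ioi fun y hy => ?_
    have hz : (-((w : ℤ) - n + 1)) = -((w - n + 1 : ℕ) : ℤ) := by
      push_cast [Nat.cast_sub hnw.le]; ring
    simp only [hz, zpow_neg, zpow_natCast, mul_assoc ((y : ℂ) ^ w)]
    rw [integral_const_mul, inner_integral hq (w - n) (by omega) hy,
      show n + (w - n) = w by omega]
    ring
  have e2 : ∫ y in Set.Ioi (0 : ℝ), (y : ℂ) ^ n * extH f (2 * Complex.I * y) =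
      (2 : ℂ)⁻¹ ^ (n + 1) * ∫ t in Set.Ioi (0 : ℝ), (t : ℂ) ^ n * extH f (Complex.I * t) := by
    have h := integral_comp_mul_left_Ioi
      (fun t : ℝ => (t : ℂ) ^ n * extH f (Complex.I * t)) 0 (b := 2) two_pos
    rw [mul_zero] at h
    have e : ∀ y : ℝ, ((2 * y : ℝ) : ℂ) ^ n * extH f (Complex.I * ((2 * y : ℝ) : ℂ)) =
        2 ^ n * ((y : ℂ) ^ n * extH f (2 * Complex.I * y)) := by
      intro y
      rw [show Complex.I * ((2 * y : ℝ) : ℂ) = 2 * Complex.I * y by push_cast; ring]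
      push_cast
      ring
    simp_rw [e] at h
    rw [integral_const_mul] at h
    rw [pow_succ, mul_assoc]
    have h' : (2 : ℂ)⁻¹ * ∫ t in Set.Ioi (0 : ℝ), (t : ℂ) ^ n * extH f (Complex.I * t) =
        2 ^ n * ∫ y in Set.Ioi (0 : ℝ), (y : ℂ) ^ n * extH f (2 * Complex.I * y) := by
      rw [h, Complex.real_smul]; push_cast; rfl
    rw [h', ← mul_assoc, ← mul_pow]
    norm_num
  have e3 : periodN n f = Complex.I ^ (n + 1) *
      ∫ t in Set.Ioi (0 : ℝ), (t : ℂ) ^ n * extH f (Complex.I * t) := by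
    unfold periodN
    rw [← integral_const_mul]
    congr 1
    ext t
    ring
  have hfac : ((w.choose n : ℕ) : ℂ) = w.factorial / (n.factorial * (w - n).factorial) := by
    rw [Nat.cast_choose ℂ hnw.le]
  rw [e1, integral_const_mul, by_parts w n hw hn hnw hd hC hb, e2, e3, hfac,
    show n + (w - n) = w by omega]
  have hz2 : (2 * Complex.I) ^ (-((n : ℤ) + 1)) = (2 : ℂ)⁻¹ ^ (n + 1) * (Complex.I ^ (n + 1))⁻¹ := by
    rw [show ((n : ℤ) + 1) = ((n + 1 : ℕ) : ℤ) by push_cast; ring, zpow_neg, zpow_natCast, mul_pow,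
      mul_inv, inv_pow]
  rw [hz2]
  have hIn : Complex.I ^ (n + 1) ≠ 0 := pow_ne_zero _ hI
  have h1 : (n.factorial : ℂ) ≠ 0 := by exact_mod_cast n.factorial_ne_zero
  have h2 : ((w - n).factorial : ℂ) ≠ 0 := by exact_mod_cast (w - n).factorial_ne_zero
  field_simp
end
end

section
/- Let N > 1 be an integer, w ≥ 2 an even integer, and n an integer with 0 < n < w, ñ = w − n. Then for every z in the upper half-plane ℍ, R_{N,w,n}(−1/(Nz)) = (−N)^{ñ+1} · z^{w+2} · R_{N,w,ñ}(z). -/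
open MeasureTheory

noncomputable section

/-- The constant `c_{w,n} = (-1)^n · 2πi · C(w,n)`. -/
def cwn (w n : ℕ) : ℂ := (-1) ^ n * (2 * (Real.pi : ℂ) * Complex.I) * (w.choose n : ℂ)

/-- The Poincaré-type series `R_{N,w,n}`, viewed as a function on `ℂ`. -/
def RG (N w n : ℕ) (z : ℂ) : ℂ :=
  (cwn w n)⁻¹ * ∑' γ : CongruenceSubgroup.Gamma0 N,
    ((γ.1.1 0 0 : ℂ) * z + (γ.1.1 0 1 : ℂ)) ^ (-((w : ℤ) - n + 1)) *
      ((γ.1.1 1 0 : ℂ) * z + (γ.1.1 1 1 : ℂ)) ^ (-((n : ℤ) + 1))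

/-- Conjugation by the Fricke involution, as a map on `Γ₀(N)`. -/
def frickeMap (N : ℕ) (hN : 1 < N) (γ : CongruenceSubgroup.Gamma0 N) :
    CongruenceSubgroup.Gamma0 N :=
  ⟨⟨!![γ.1.1 1 1, -(γ.1.1 1 0 / N); -(γ.1.1 0 1 * N), γ.1.1 0 0], by
    have hd : (N : ℤ) ∣ γ.1.1 1 0 := by
      have := γ.2
      rw [CongruenceSubgroup.Gamma0_mem] at this
      exact (ZMod.intCast_zmod_eq_zero_iff_dvd _ _).1 this
    have h := γ.1.2
    rw [Matrix.det_fin_two] at h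
    rw [Matrix.det_fin_two_of]
    have h2 := Int.ediv_mul_cancel hd
    linear_combination h - γ.1.1 0 1 * h2⟩, by
    refine CongruenceSubgroup.Gamma0_mem.2 ?_
    simp⟩

lemma fricke_dvd (N : ℕ) (γ : CongruenceSubgroup.Gamma0 N) : (N : ℤ) ∣ γ.1.1 1 0 := by
  have := γ.2
  rw [CongruenceSubgroup.Gamma0_mem] at this
  exact (ZMod.intCast_zmod_eq_zero_iff_dvd _ _).1 this

lemma frickeMap_invol (N : ℕ) (hN : 1 < N) : Function.Involutive (frickeMap N hN) := by
  intro γ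
  have h2 := Int.ediv_mul_cancel (fricke_dvd N γ)
  have h0 : (N : ℤ) ≠ 0 := by omega
  have h3 : -(-(γ.1.1 0 1 * (N : ℤ)) / N) = γ.1.1 0 1 := by
    rw [← neg_mul, Int.mul_ediv_cancel _ h0, neg_neg]
  apply Subtype.ext
  apply Subtype.ext
  ext i j
  fin_cases i <;> fin_cases j
  · simp [frickeMap]
  · simpa [frickeMap] using h3
  · simpa [frickeMap] using h2
  · simp [frickeMap]

theorem R_atkin_lehner (N w n : ℕ) (hN : 1 < N) (hw : 2 ≤ w) (hwe : Even w)
    (hn : 0 < n) (hnw : n < w) (z : ℂ) (hz : 0 < z.im) :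
    RG N w n (-1 / ((N : ℂ) * z)) = (-(N : ℂ)) ^ (w - n + 1) * z ^ (w + 2) * RG N w (w - n) z := by
  have hz0 : z ≠ 0 := by rintro rfl; simp at hz
  have hN0 : (N : ℂ) ≠ 0 := by
    have : N ≠ 0 := by omega
    exact_mod_cast this
  have hc : cwn w (w - n) = cwn w n := by
    unfold cwn
    rw [Nat.choose_symm hnw.le]
    congr 2
    have h1 : ((-1 : ℂ)) ^ (w - n) * (-1) ^ n = 1 := by
      rw [← pow_add, Nat.sub_add_cancel hnw.le, hwe.neg_one_pow]
    have h2 : ((-1 : ℂ)) ^ n * (-1) ^ n = 1 := by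
      rw [← mul_pow]; simp
    have h3 : ((-1 : ℂ)) ^ n ≠ 0 := by simp
    exact mul_right_cancel₀ h3 (h1.trans h2.symm)
  unfold RG
  rw [hc, mul_left_comm]
  congr 1
  rw [← tsum_mul_left]
  refine Eq.trans ?_ (Equiv.tsum_eq (Function.Involutive.toPerm _ (frickeMap_invol N hN)) _)
  apply tsum_congr
  intro γ
  obtain ⟨k, hk⟩ := fricke_dvd N γ
  have hNZ : (N : ℤ) ≠ 0 := by omega
  have e1 : -((w : ℤ) - n + 1) = -((w - n + 1 : ℕ) : ℤ) := by omega
  have e2 : -((n : ℤ) + 1) = -((n + 1 : ℕ) : ℤ) := by omega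
  have e3 : -((w : ℤ) - (w - n : ℕ) + 1) = -((n + 1 : ℕ) : ℤ) := by omega
  have e4 : -(((w - n : ℕ) : ℤ) + 1) = -((w - n + 1 : ℕ) : ℤ) := by omega
  have e5 : w + 2 = (w - n + 1) + (n + 1) := by omega
  rw [e1, e2, e3, e4, e5]
  generalize w - n + 1 = p
  generalize n + 1 = q
  simp only [Function.Involutive.coe_toPerm, frickeMap, Matrix.of_apply, Matrix.cons_val', Matrix.cons_val_zero,
    Matrix.cons_val_one, Matrix.cons_val_fin_one, hk, Int.mul_ediv_cancel_left _ hNZ]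
  push_cast
  generalize (γ.1.1 0 0 : ℂ) = a
  generalize (γ.1.1 0 1 : ℂ) = b
  generalize (γ.1.1 1 1 : ℂ) = d
  have f1 : a * (-1 / (N * z)) + b = (-(b * N) * z + a) * ((-N) * z)⁻¹ := by
    field_simp
    ring
  have f2 : (N : ℂ) * k * (-1 / (N * z)) + d = (d * z + -k) * z⁻¹ := by
    field_simp
    ring
  rw [f1, f2]
  simp only [zpow_neg, zpow_natCast, mul_pow, inv_pow, mul_inv, inv_inv, pow_add]
  ring
end
end

section
/- Let N > 1 and m ≥ 1 be integers. Let H_{N,m} be the set of 2×2 integer matrices [a,b;c,d] with ad − bc = m, N | c, and gcd(a,N) = 1, and let M_{N,m} be the set of matrices [a,b;0,d] with a, d positive integers, ad = m, gcd(a,N) = 1, and 0 ≤ b ≤ d−1. Then H_{N,m} = Γ₀(N) · M_{N,m}; that is, a 2×2 integer matrix A lies in H_{N,m} if and only if there exist γ ∈ Γ₀(N) (regarded as an integer matrix) and α ∈ M_{N,m} with A = γ·α. -/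
noncomputable section

/-- `H_{N,m}`: integer matrices `[a,b;c,d]` with `ad−bc = m`, `N ∣ c`, `gcd(a,N) = 1`. -/
def Hset (N m : ℕ) : Set (Matrix (Fin 2) (Fin 2) ℤ) :=
  {A | A 0 0 * A 1 1 - A 0 1 * A 1 0 = (m : ℤ) ∧ (N : ℤ) ∣ A 1 0 ∧ Int.gcd (A 0 0) (N : ℤ) = 1}

theorem Hset_eq_gamma0_mul_standard_reps (N m : ℕ) (hN : 1 < N) (hm : 1 ≤ m)
    (A : Matrix (Fin 2) (Fin 2) ℤ) :
    A ∈ Hset N m ↔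
      ∃ (γ : CongruenceSubgroup.Gamma0 N) (α : Matrix (Fin 2) (Fin 2) ℤ),
        (∃ a d b : ℕ, 0 < a ∧ 0 < d ∧ a * d = m ∧ Nat.gcd a N = 1 ∧ b < d ∧
            α = !![(a : ℤ), (b : ℤ); 0, (d : ℤ)]) ∧
          A = (γ.1.1 : Matrix (Fin 2) (Fin 2) ℤ) * α := by
  constructor
  · rintro ⟨hdet, hNc, hg⟩
    generalize hx : A 0 0 = x at *
    generalize hy : A 0 1 = y at *
    generalize hz : A 1 0 = z at *
    generalize hw : A 1 1 = w at *
    have hm' : (0 : ℤ) < m := by exact_mod_cast hm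
    have hgpos : 0 < Int.gcd x z := by
      rw [Int.gcd_pos_iff]
      by_contra! h
      rw [h.1, h.2] at hdet
      simp at hdet
      omega
    obtain ⟨p, r, hpr, hxp, hzr⟩ := Int.exists_gcd_one hgpos
    generalize hG : Int.gcd x z = g at *
    have hcop : IsCoprime p r := Int.isCoprime_iff_gcd_eq_one.mpr hpr
    obtain ⟨s, t, hst⟩ := hcop
    have hg0 : (0 : ℤ) < g := by exact_mod_cast hgpos
    have hgd : (g : ℤ) * (p * w - r * y) = m := by rw [← hdet, hxp, hzr]; ring
    have hdpos : 0 < p * w - r * y := by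
      by_contra! h
      nlinarith
    have hxN : IsCoprime x (N : ℤ) := Int.isCoprime_iff_gcd_eq_one.mpr hg
    have hgN : IsCoprime (g : ℤ) (N : ℤ) := by
      rw [hxp] at hxN
      exact hxN.of_mul_left_right
    have hNr : (N : ℤ) ∣ r := by
      rw [hzr] at hNc
      exact hgN.symm.dvd_of_dvd_mul_right hNc
    obtain ⟨d, hd⟩ := Int.eq_ofNat_of_zero_le hdpos.le
    have hd0 : (0 : ℤ) < d := by rw [← hd]; exact hdpos
    obtain ⟨b, hb⟩ := Int.eq_ofNat_of_zero_le (Int.emod_nonneg (s * y + t * w) hd0.ne')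
    have hbd := Int.emod_lt_of_pos (s * y + t * w) hd0
    have hk := Int.emod_add_mul_ediv (s * y + t * w) d
    generalize (s * y + t * w) / (d : ℤ) = k at *
    rw [hb] at hbd hk
    let γ : Matrix.SpecialLinearGroup (Fin 2) ℤ :=
      ⟨!![p, -t + k * p; r, s + k * r], by rw [Matrix.det_fin_two_of]; linear_combination hst⟩
    have hγ : γ ∈ CongruenceSubgroup.Gamma0 N := by
      rw [CongruenceSubgroup.Gamma0_mem]
      exact (ZMod.intCast_zmod_eq_zero_iff_dvd _ _).mpr hNr
    refine ⟨⟨γ, hγ⟩, !![(g : ℤ), (b : ℤ); 0, (d : ℤ)],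
      ⟨g, d, b, hgpos, by exact_mod_cast hd0, ?_, ?_, by exact_mod_cast hbd, rfl⟩, ?_⟩
    · rw [hd] at hgd
      exact_mod_cast hgd
    · exact Nat.isCoprime_iff_coprime.mp hgN
    · have h1 : y = p * b + (-t + k * p) * d := by
        linear_combination (-y) * hst - p * hk - t * hd
      have h2 : w = r * b + (s + k * r) * d := by
        linear_combination (-w) * hst - r * hk + s * hd
      ext i j
      fin_cases i <;> fin_cases j <;>
        simp [γ, Matrix.mul_apply, Fin.sum_univ_two, hx, hy, hz, hw] <;> assumption
  · rintro ⟨⟨γ, hγ⟩, α, ⟨a, d, b, ha, hd, had, hgcd, hb, rfl⟩, rfl⟩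
    rw [CongruenceSubgroup.Gamma0_mem] at hγ
    have hr : (N : ℤ) ∣ γ.1 1 0 := (ZMod.intCast_zmod_eq_zero_iff_dvd _ _).mp hγ
    have hdet := γ.2
    rw [Matrix.det_fin_two] at hdet
    have had' : (a : ℤ) * d = m := by exact_mod_cast had
    have haN : IsCoprime (a : ℤ) (N : ℤ) := Nat.isCoprime_iff_coprime.mpr hgcd
    have hpN : IsCoprime (γ.1 0 0) (N : ℤ) := by
      obtain ⟨c, hc⟩ := hr
      refine ⟨γ.1 1 1, -(γ.1 0 1) * c, ?_⟩
      rw [hc] at hdet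
      linear_combination hdet
    refine ⟨?_, ?_, ?_⟩
    · simp only [Matrix.mul_apply, Fin.sum_univ_two, Matrix.of_apply, Matrix.cons_val_zero,
        Matrix.cons_val_one, Matrix.cons_val', Matrix.cons_val_fin_one]
      linear_combination (a : ℤ) * d * hdet + had'
    · simpa [Matrix.mul_apply, Fin.sum_univ_two] using hr.mul_right (a : ℤ)
    · rw [← Int.isCoprime_iff_gcd_eq_one]
      simpa [Matrix.mul_apply, Fin.sum_univ_two] using hpN.mul_left haN
end
end

section
/- Let d ≥ 1 be an integer and let w be an even integer with w ≥ 4d + 2. Then det_{1 ≤ i,j ≤ d} [ ζ(w − 2i − 2j + 2) ] = Σ_{1 ≤ m₁ < m₂ < … < m_d} Π_{1 ≤ i < j ≤ d} (m_i² − m_j²)² · Π_{i=1}^{d} m_i^{2−w}, where ζ is the Riemann zeta function and the (absolutely convergent) sum runs over all strictly increasing d-tuples of positive integers; in particular, this determinant is strictly positive. -/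
noncomputable section

/-- The Riemann zeta value `ζ(s) = Σ_{m≥1} m^{−s}` for a natural number argument. -/
def zetaNat (s : ℕ) : ℝ := ∑' m : ℕ+, (1 : ℝ) / (m : ℝ) ^ s

lemma hasSum_pi_prod {α : Type*} (d : ℕ) (f : Fin d → α → ℝ) (a : Fin d → ℝ)
    (h0 : ∀ i x, 0 ≤ f i x) (h : ∀ i, HasSum (f i) (a i)) :
    HasSum (fun m : Fin d → α => ∏ i, f i (m i)) (∏ i, a i) := by
  induction d with
  | zero =>
    simp only [Finset.univ_eq_empty, Finset.prod_empty]
    simpa only [Finset.univ_unique, Finset.sum_singleton] using hasSum_fintype (fun _ : Fin 0 → α => (1 : ℝ))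
  | succ n ih =>
    have h1 := ih (fun i => f i.succ) (fun i => a i.succ) (fun i x => h0 _ x) (fun i => h _)
    have h3 : Summable (fun x : α × (Fin n → α) => f 0 x.1 * ∏ i, f (Fin.succ i) (x.2 i)) :=
      Summable.mul_of_nonneg (f := f 0) (g := fun m : Fin n → α => ∏ i, f (Fin.succ i) (m i))
        (h 0).summable h1.summable (fun x => h0 0 x)
        (fun m => Finset.prod_nonneg fun i _ => h0 (Fin.succ i) (m i))
    have h2 := (h 0).mul h1 h3
    rw [← (Fin.consEquiv (fun _ : Fin (n + 1) => α)).hasSum_iff, Fin.prod_univ_succ]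
    refine (congrArg (fun F => HasSum F _) (funext ?_)).mpr h2
    intro x
    simp [Fin.consEquiv, Fin.prod_univ_succ]

/-- Symmetrization identity. -/
lemma sum_perm_eq (d : ℕ) (u x : Fin d → ℝ) :
    ∑ τ : Equiv.Perm (Fin d), ∑ σ : Equiv.Perm (Fin d), ((Equiv.Perm.sign σ : ℤ) : ℝ) *
      ∏ i, (u (τ i) * x (τ i) ^ (σ i : ℕ) * x (τ i) ^ (i : ℕ)) =
    (Matrix.vandermonde x).det ^ 2 * ∏ i, u i := by
  have hin : ∀ τ : Equiv.Perm (Fin d), ∑ σ : Equiv.Perm (Fin d), ((Equiv.Perm.sign σ : ℤ) : ℝ) *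
      ∏ i, (u (τ i) * x (τ i) ^ (σ i : ℕ) * x (τ i) ^ (i : ℕ)) =
      (∏ i, u i) * (Matrix.vandermonde x).det *
        (((Equiv.Perm.sign τ : ℤ) : ℝ) * ∏ i, Matrix.vandermonde x (τ i) i) := by
    intro τ
    have h1 := Matrix.det_permute τ (Matrix.vandermonde x)
    rw [← Matrix.det_transpose, Matrix.det_apply'] at h1
    simp only [Matrix.transpose_apply, Matrix.submatrix_apply, Matrix.vandermonde_apply, id] at h1
    simp only [Finset.prod_mul_distrib, Equiv.prod_comp τ u, Matrix.vandermonde_apply]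
    calc _ = (∏ i, u i) * (∏ i, x (τ i) ^ (i : ℕ)) * ∑ σ : Equiv.Perm (Fin d),
          ((Equiv.Perm.sign σ : ℤ) : ℝ) * ∏ i, x (τ i) ^ (σ i : ℕ) := by
          rw [Finset.mul_sum]
          exact Finset.sum_congr rfl fun σ _ => by ring
      _ = _ := by rw [h1]; ring
  rw [Finset.sum_congr rfl fun τ _ => hin τ, ← Finset.mul_sum, ← Matrix.det_apply']
  ring

lemma vandermonde_sq (d : ℕ) (x : Fin d → ℝ) :
    (∏ i : Fin d, ∏ j : Fin d, if i < j then (x i - x j) ^ 2 else 1) =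
      (Matrix.vandermonde x).det ^ 2 := by
  rw [Matrix.det_vandermonde, ← Finset.prod_pow]
  refine Finset.prod_congr rfl fun i _ => ?_
  rw [← Finset.prod_pow, ← Finset.prod_filter]
  refine Finset.prod_congr (by ext; simp) fun j _ => by ring

lemma zetaNat_hasSum (d w : ℕ) (hw : 4 * d + 2 ≤ w) (i j : Fin d) :
    HasSum (fun m : ℕ+ => ((m : ℕ) : ℝ) ^ ((2 : ℤ) - (w : ℤ)) * (((m : ℕ) : ℝ) ^ 2) ^ (i : ℕ) *
      (((m : ℕ) : ℝ) ^ 2) ^ (j : ℕ))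
      (zetaNat (w - 2 * (i.1 + 1) - 2 * (j.1 + 1) + 2)) := by
  have hi := i.2
  have hj := j.2
  have hs : Summable (fun n : ℕ => (1 : ℝ) / (n : ℝ) ^ (w - 2 * (i.1 + 1) - 2 * (j.1 + 1) + 2)) :=
    Real.summable_one_div_nat_pow.2 (by omega)
  have h := (hs.comp_injective PNat.coe_injective).hasSum
  unfold zetaNat
  refine (congrArg (fun F => HasSum F _) (funext ?_)).mpr h
  intro m
  have hm : ((m : ℕ) : ℝ) ≠ 0 := by exact_mod_cast m.ne_zero
  simp only [Function.comp, one_div]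
  rw [← pow_mul, ← pow_mul, ← zpow_natCast, ← zpow_natCast, ← zpow_natCast, ← zpow_neg,
    ← zpow_add₀ hm, ← zpow_add₀ hm]
  congr 1
  omega

/-- Rearranging a strictly increasing tuple. -/
def rearr (d : ℕ) (p : {m : Fin d → ℕ // StrictMono m ∧ ∀ i, 0 < m i} × Equiv.Perm (Fin d)) :
    Fin d → ℕ+ := fun i => ⟨p.1.1 (p.2 i), p.1.2.2 _⟩

lemma rearr_injective (d : ℕ) : Function.Injective (rearr d) := by
  rintro ⟨⟨m, hm, hm0⟩, σ⟩ ⟨⟨m', hm', hm0'⟩, σ'⟩ h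
  have h1 : m ∘ σ = m' ∘ σ' := by
    funext i
    exact congrArg PNat.val (congrFun h i)
  have h2 : Set.range m = Set.range m' := by
    rw [← EquivLike.range_comp m σ, h1, EquivLike.range_comp]
  obtain rfl := (hm.range_inj hm').1 h2
  have h3 : σ = σ' := Equiv.ext fun i => hm.injective (congrFun h1 i)
  rw [h3]

lemma mem_range_rearr (d : ℕ) (m : Fin d → ℕ+) (hm : Function.Injective m) :
    m ∈ Set.range (rearr d) := by
  refine ⟨⟨⟨fun i => (m (Tuple.sort m i) : ℕ), ?_, fun i => (m _).pos⟩, (Tuple.sort m).symm⟩, ?_⟩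
  · have := (Tuple.monotone_sort m).strictMono_of_injective
      (hm.comp (Tuple.sort m).injective)
    exact fun i j hij => this hij
  · funext i
    apply PNat.eq
    simp [rearr]

lemma main_hasSum (d w : ℕ) (hw : 4 * d + 2 ≤ w) :
    HasSum (fun m : {m : Fin d → ℕ // StrictMono m ∧ ∀ i, 0 < m i} =>
      (∏ i : Fin d, ∏ j : Fin d,
          if i < j then ((m.1 i : ℝ) ^ 2 - (m.1 j : ℝ) ^ 2) ^ 2 else 1) *
        ∏ i : Fin d, (m.1 i : ℝ) ^ ((2 : ℤ) - (w : ℤ)))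
      (Matrix.of fun i j : Fin d => zetaNat (w - 2 * (i.1 + 1) - 2 * (j.1 + 1) + 2)).det := by
  have h1 : HasSum (fun m : Fin d → ℕ+ => ∑ σ : Equiv.Perm (Fin d),
      ((Equiv.Perm.sign σ : ℤ) : ℝ) * ∏ i, (((m i : ℕ) : ℝ) ^ ((2 : ℤ) - (w : ℤ)) *
        (((m i : ℕ) : ℝ) ^ 2) ^ (σ i : ℕ) * (((m i : ℕ) : ℝ) ^ 2) ^ (i : ℕ)))
      (Matrix.of fun i j : Fin d => zetaNat (w - 2 * (i.1 + 1) - 2 * (j.1 + 1) + 2)).det := by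
    rw [Matrix.det_apply']
    refine hasSum_sum fun σ _ => HasSum.mul_left _ ?_
    exact hasSum_pi_prod d (fun i (m : ℕ+) => ((m : ℕ) : ℝ) ^ ((2 : ℤ) - (w : ℤ)) *
        (((m : ℕ) : ℝ) ^ 2) ^ (σ i : ℕ) * (((m : ℕ) : ℝ) ^ 2) ^ (i : ℕ)) _
      (fun i m => by positivity) (fun i => zetaNat_hasSum d w hw (σ i) i)
  rw [← (rearr_injective d).hasSum_iff] at h1
  · refine h1.prod_fiberwise fun m => ?_
    rw [vandermonde_sq d (fun i => (m.1 i : ℝ) ^ 2),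
      ← sum_perm_eq d (fun i => (m.1 i : ℝ) ^ ((2 : ℤ) - (w : ℤ))) (fun i => (m.1 i : ℝ) ^ 2)]
    exact hasSum_fintype _
  · intro m hm
    have hni : ¬ Function.Injective m := fun h => hm (mem_range_rearr d m h)
    obtain ⟨a, b, hab, hne⟩ : ∃ a b, m a = m b ∧ a ≠ b := by
      simpa [Function.Injective] using hni
    have hdet : (Matrix.vandermonde fun i => ((m i : ℕ) : ℝ) ^ 2).det = 0 :=
      Matrix.det_zero_of_row_eq hne (by funext j; simp [Matrix.vandermonde_apply, hab])
    rw [← Matrix.det_transpose, Matrix.det_apply'] at hdet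
    simp only [Matrix.transpose_apply, Matrix.vandermonde_apply] at hdet
    simp only [Finset.prod_mul_distrib]
    calc _ = (∏ i, ((m i : ℕ) : ℝ) ^ ((2 : ℤ) - (w : ℤ))) *
          (∏ i, (((m i : ℕ) : ℝ) ^ 2) ^ (i : ℕ)) * ∑ σ : Equiv.Perm (Fin d),
          ((Equiv.Perm.sign σ : ℤ) : ℝ) * ∏ i, (((m i : ℕ) : ℝ) ^ 2) ^ (σ i : ℕ) := by
          rw [Finset.mul_sum]
          exact Finset.sum_congr rfl fun σ _ => by ring
      _ = 0 := by rw [hdet, mul_zero]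

lemma term_pos (d w : ℕ) (m : {m : Fin d → ℕ // StrictMono m ∧ ∀ i, 0 < m i}) :
    0 < (∏ i : Fin d, ∏ j : Fin d,
          if i < j then ((m.1 i : ℝ) ^ 2 - (m.1 j : ℝ) ^ 2) ^ 2 else 1) *
        ∏ i : Fin d, (m.1 i : ℝ) ^ ((2 : ℤ) - (w : ℤ)) := by
  refine mul_pos (Finset.prod_pos fun i _ => Finset.prod_pos fun j _ => ?_)
    (Finset.prod_pos fun i _ => zpow_pos (by exact_mod_cast m.2.2 i) _)
  split_ifs with h
  · have h1 : (m.1 i : ℝ) < m.1 j := by exact_mod_cast m.2.1 h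
    have h2 : (0 : ℝ) < m.1 i := by exact_mod_cast m.2.2 i
    have h3 : (m.1 i : ℝ) ^ 2 - (m.1 j : ℝ) ^ 2 ≠ 0 := by nlinarith
    positivity
  · exact one_pos

theorem zeta_hankel_det (d w : ℕ) (hd : 1 ≤ d) (hwe : Even w) (hw : 4 * d + 2 ≤ w) :
    Summable (fun m : {m : Fin d → ℕ // StrictMono m ∧ ∀ i, 0 < m i} =>
      (∏ i : Fin d, ∏ j : Fin d,
          if i < j then ((m.1 i : ℝ) ^ 2 - (m.1 j : ℝ) ^ 2) ^ 2 else 1) *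
        ∏ i : Fin d, (m.1 i : ℝ) ^ ((2 : ℤ) - (w : ℤ))) ∧
    ((Matrix.of fun i j : Fin d => zetaNat (w - 2 * (i.1 + 1) - 2 * (j.1 + 1) + 2)).det =
      ∑' m : {m : Fin d → ℕ // StrictMono m ∧ ∀ i, 0 < m i},
        ((∏ i : Fin d, ∏ j : Fin d,
            if i < j then ((m.1 i : ℝ) ^ 2 - (m.1 j : ℝ) ^ 2) ^ 2 else 1) *
          ∏ i : Fin d, (m.1 i : ℝ) ^ ((2 : ℤ) - (w : ℤ)))) ∧
    0 < (Matrix.of fun i j : Fin d => zetaNat (w - 2 * (i.1 + 1) - 2 * (j.1 + 1) + 2)).det := by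
  have H := main_hasSum d w hw
  refine ⟨H.summable, H.tsum_eq.symm, ?_⟩
  rw [← H.tsum_eq]
  exact H.summable.tsum_pos (fun m => (term_pos d w m).le)
    ⟨fun i => i.1 + 1, fun i j h => Nat.add_lt_add_right h 1, fun i => Nat.succ_pos _⟩
    (term_pos d w _)
end
end
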